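/- arXiv:2110.00102 — 2 statements merged into one kernel-verified Lean document; each statement's English description precedes it below -/
import Mathlib

section
/- Let 𝔽_q be a finite field of odd cardinality q. Let Δ ∈ 𝔽_q[T] be nonzero and let M ∈ 𝔽_q[T] be monic, squarefree and nonconstant with M ∣ Δ. For each monic irreducible divisor P of M let η_P denote the quadratic character of the finite field 𝔽_q[T]/(P), and for D ∈ 𝔽_q[T] coprime to M set χ(D) := ∏_{P ∣ M} η_P(D mod P). Then there exists a constant C (depending on q, Δ and M) such that for every N ≥ 1 and each sign s ∈ {+1, −1}: | #{D ∈ H_N(Δ) : χ(D) = s} − (1/2)·#H_N(Δ) | ≤ C·q^{N/2}. -/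
open Polynomial UniqueFactorizationMonoid

section

variable {F : Type*} [Field F]

/-- The finite set of polynomials of degree less than `n` over a finite field. -/
noncomputable def degreeLTFinset (F : Type*) [Field F] [Fintype F] (n : ℕ) : Finset F[X] :=
  (Finset.univ : Finset (Fin n → F)).map
    ((degreeLTEquiv F n).symm.toEquiv.toEmbedding.trans (Function.Embedding.subtype _))

lemma mem_degreeLTFinset [Fintype F] {n : ℕ} {D : F[X]} :
    D ∈ degreeLTFinset F n ↔ D.degree < n := by
  simp only [degreeLTFinset, Finset.mem_map, Finset.mem_univ, true_and]
  rw [← mem_degreeLT]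
  constructor
  · rintro ⟨v, rfl⟩
    exact ((degreeLTEquiv F n).symm v).2
  · intro h
    exact ⟨degreeLTEquiv F n ⟨D, h⟩, by simp⟩

lemma card_degreeLTFinset [Fintype F] (n : ℕ) :
    (degreeLTFinset F n).card = Fintype.card F ^ n := by
  classical
  simp [degreeLTFinset]

open Classical in
/-- The finite set of monic polynomials of degree `n` coprime to `Δ`. -/
noncomputable def monicCoprime [Fintype F] (Δ : F[X]) (n : ℕ) : Finset F[X] :=
  (degreeLTFinset F (n + 1)).filter fun D => D.Monic ∧ D.natDegree = n ∧ IsCoprime D Δ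

lemma mem_monicCoprime [Fintype F] {Δ D : F[X]} {n : ℕ} :
    D ∈ monicCoprime Δ n ↔ D.Monic ∧ D.natDegree = n ∧ IsCoprime D Δ := by
  simp only [monicCoprime, Finset.mem_filter, mem_degreeLTFinset, and_iff_right_iff_imp]
  rintro ⟨hD, rfl, -⟩
  rw [degree_eq_natDegree hD.ne_zero]
  exact_mod_cast Nat.lt_succ_self _

lemma degree_lt_of_mem_monicCoprime [Fintype F] {Δ D : F[X]} {n k : ℕ}
    (hD : D ∈ monicCoprime Δ n) (hk : n < k) : D.degree < k := by
  obtain ⟨hmon, rfl, -⟩ := mem_monicCoprime.1 hD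
  rw [degree_eq_natDegree hmon.ne_zero]
  exact_mod_cast hk

lemma isCoprime_of_dvd_sub {A B Δ : F[X]} (hA : IsCoprime A Δ) (h : Δ ∣ B - A) :
    IsCoprime B Δ := by
  obtain ⟨k, hk⟩ := h
  have : B = A + Δ * k := by linear_combination hk
  rw [this]
  exact IsCoprime.add_mul_left_left hA k

/-- Change the residue of `D` modulo `Δ` into that of `G * D`, keeping the quotient. -/
noncomputable def twistResidue (Δ G D : F[X]) : F[X] := D + (G * D % Δ - D % Δ)

lemma dvd_twistResidue_sub (Δ G D : F[X]) : Δ ∣ twistResidue Δ G D - G * D := by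
  refine ⟨D / Δ - G * D / Δ, ?_⟩
  unfold twistResidue
  linear_combination EuclideanDomain.div_add_mod (G * D) Δ - EuclideanDomain.div_add_mod D Δ

lemma twistResidue_mem [Fintype F] {Δ G D : F[X]} (hΔ : Δ ≠ 0) (hG : IsCoprime G Δ) {n : ℕ}
    (hn : Δ.natDegree ≤ n) (hD : D ∈ monicCoprime Δ n) :
    twistResidue Δ G D ∈ monicCoprime Δ n := by
  rw [mem_monicCoprime] at hD ⊢
  obtain ⟨hmon, hdeg, hcop⟩ := hD
  have hlt : (G * D % Δ - D % Δ).degree < D.degree := by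
    refine ((degree_sub_le _ _).trans_lt (max_lt (degree_mod_lt _ hΔ) (degree_mod_lt _ hΔ))).trans_le
      ?_
    rw [degree_eq_natDegree hΔ, degree_eq_natDegree hmon.ne_zero]
    exact_mod_cast hdeg ▸ hn
  exact ⟨hmon.add_of_left hlt, (natDegree_add_eq_left_of_degree_lt hlt).trans hdeg,
    isCoprime_of_dvd_sub (hG.mul_left hcop) (dvd_twistResidue_sub Δ G D)⟩

lemma twistResidue_injective {Δ G : F[X]} (hG : IsCoprime G Δ) :
    Function.Injective (twistResidue Δ G) := by
  intro A B h
  have hdvd : Δ ∣ A - B := by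
    have h1 := dvd_sub (dvd_twistResidue_sub Δ G B) (dvd_twistResidue_sub Δ G A)
    rw [h, sub_sub_sub_cancel_left, ← mul_sub] at h1
    exact hG.symm.dvd_of_dvd_mul_left h1
  have hmod : ∀ X Y : F[X], Δ ∣ X - Y → X % Δ = Y % Δ := fun X Y hXY => by
    rw [← sub_eq_zero, ← Polynomial.sub_mod]
    exact EuclideanDomain.mod_eq_zero.2 hXY
  have h1 := hmod A B hdvd
  have h2 := hmod (G * A) (G * B) (by rw [← mul_sub]; exact hdvd.mul_left G)
  unfold twistResidue at h
  rw [h1, h2] at h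
  exact add_right_cancel h

variable [Fintype F] {Δ : F[X]} {χ : F[X] →* ℤ}

lemma sum_monicCoprime_eq_zero (hΔ : Δ ≠ 0) (hper : ∀ A B, Δ ∣ A - B → χ A = χ B)
    {G : F[X]} (hG : IsCoprime G Δ) (hχG : χ G = -1) {n : ℕ} (hn : Δ.natDegree ≤ n) :
    ∑ D ∈ monicCoprime Δ n, χ D = 0 := by
  have hmaps : Set.MapsTo (twistResidue Δ G) (monicCoprime Δ n) (monicCoprime Δ n) :=
    fun D hD => twistResidue_mem hΔ hG hn hD
  have hinj : Set.InjOn (twistResidue Δ G) (monicCoprime Δ n) :=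
    (twistResidue_injective hG).injOn
  have key : ∑ D ∈ monicCoprime Δ n, -χ D = ∑ D ∈ monicCoprime Δ n, χ D :=
    Finset.sum_nbij _ hmaps hinj
      (Finset.surjOn_of_injOn_of_card_le _ hmaps hinj le_rfl) fun D _ => by
        rw [hper _ _ (dvd_twistResidue_sub Δ G D), map_mul, hχG, neg_one_mul]
  rw [Finset.sum_neg_distrib] at key
  lia

lemma abs_sum_monicCoprime_le (hΔ : Δ ≠ 0) (hper : ∀ A B, Δ ∣ A - B → χ A = χ B)
    (hunit : ∀ D, IsCoprime D Δ → χ D = 1 ∨ χ D = -1)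
    {G : F[X]} (hG : IsCoprime G Δ) (hχG : χ G = -1) (n : ℕ) :
    |∑ D ∈ monicCoprime Δ n, χ D| ≤ (Fintype.card F : ℤ) ^ Δ.natDegree := by
  rcases le_or_gt Δ.natDegree n with hn | hn
  · rw [sum_monicCoprime_eq_zero hΔ hper hG hχG hn, abs_zero]
    positivity
  · calc |∑ D ∈ monicCoprime Δ n, χ D| ≤ ∑ D ∈ monicCoprime Δ n, |χ D| :=
          Finset.abs_sum_le_sum_abs _ _
      _ ≤ ∑ D ∈ monicCoprime Δ n, 1 := Finset.sum_le_sum fun D hD => by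
          rcases hunit D (mem_monicCoprime.1 hD).2.2 with h | h <;> simp [h]
      _ = ((monicCoprime Δ n).card : ℤ) := by simp
      _ ≤ ((degreeLTFinset F Δ.natDegree).card : ℤ) := by
          exact_mod_cast Finset.card_le_card fun D hD =>
            mem_degreeLTFinset.2 (degree_lt_of_mem_monicCoprime hD hn)
      _ = (Fintype.card F : ℤ) ^ Δ.natDegree := by rw [card_degreeLTFinset]; push_cast; rfl

open Classical in
lemma abs_sum_sq_dvd_le (hΔ : Δ ≠ 0) (hper : ∀ A B, Δ ∣ A - B → χ A = χ B)
    (hunit : ∀ D, IsCoprime D Δ → χ D = 1 ∨ χ D = -1)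
    {G : F[X]} (hG : IsCoprime G Δ) (hχG : χ G = -1) {E : F[X]} (hE : E.Monic) (n : ℕ) :
    |∑ D ∈ monicCoprime Δ n with E ^ 2 ∣ D, χ D| ≤
      if E.natDegree ≤ n / 2 then (Fintype.card F : ℤ) ^ Δ.natDegree else 0 := by
  by_cases hempty : (monicCoprime Δ n).filter (E ^ 2 ∣ ·) = ∅
  · rw [hempty, Finset.sum_empty, abs_zero]
    split_ifs <;> positivity
  obtain ⟨D₀, hD₀⟩ := Finset.nonempty_iff_ne_empty.2 hempty
  obtain ⟨hD₀, hdvd⟩ := Finset.mem_filter.1 hD₀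
  obtain ⟨hmon, hdeg, hcop⟩ := mem_monicCoprime.1 hD₀
  have hEcop : IsCoprime (E ^ 2) Δ := hcop.of_isCoprime_of_dvd_left hdvd
  have hEn : 2 * E.natDegree ≤ n := by
    rw [← natDegree_pow, ← hdeg]
    exact natDegree_le_of_dvd hdvd hmon.ne_zero
  have hχE : χ (E ^ 2) = 1 := by
    rcases hunit E ((IsCoprime.pow_left_iff two_pos).1 hEcop) with h | h <;> simp [h]
  have hsum : ∑ D ∈ monicCoprime Δ n with E ^ 2 ∣ D, χ D =
      ∑ D ∈ monicCoprime Δ (n - 2 * E.natDegree), χ D := by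
    symm
    refine Finset.sum_nbij (E ^ 2 * ·) ?_ ?_ ?_ ?_
    · intro D hD
      obtain ⟨h1, h2, h3⟩ := mem_monicCoprime.1 hD
      refine Finset.mem_filter.2 ⟨mem_monicCoprime.2 ⟨(hE.pow 2).mul h1, ?_, hEcop.mul_left h3⟩,
        dvd_mul_right _ _⟩
      rw [(hE.pow 2).natDegree_mul h1, natDegree_pow, h2]
      lia
    · exact (mul_right_injective₀ (pow_ne_zero 2 hE.ne_zero)).injOn
    · intro D hD
      obtain ⟨hD, K, rfl⟩ := Finset.mem_filter.1 hD
      obtain ⟨h1, h2, h3⟩ := mem_monicCoprime.1 hD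
      have hK := (hE.pow 2).of_mul_monic_left h1
      refine ⟨K, mem_monicCoprime.2 ⟨hK, ?_, h3.of_mul_left_right⟩, rfl⟩
      rw [(hE.pow 2).natDegree_mul hK, natDegree_pow] at h2
      lia
    · intro D _
      rw [map_mul, hχE, one_mul]
  rw [hsum, if_pos (by lia)]
  exact abs_sum_monicCoprime_le hΔ hper hunit hG hχG _

open Classical in
/-- The monic irreducible polynomials of degree at most `n`. -/
noncomputable def monicIrreducibles (F : Type*) [Field F] [Fintype F] (n : ℕ) : Finset F[X] :=
  (degreeLTFinset F (n + 1)).filter fun P => P.Monic ∧ Irreducible P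

lemma mem_monicIrreducibles {n : ℕ} {P : F[X]} :
    P ∈ monicIrreducibles F n ↔ P.degree < (n + 1 : ℕ) ∧ P.Monic ∧ Irreducible P := by
  simp [monicIrreducibles, mem_degreeLTFinset]

lemma Polynomial.Monic.eq_of_irreducible_of_dvd {F : Type*} [Field F] {P Q : F[X]}
    (hP : P.Monic) (hQ : Q.Monic) (hP' : Irreducible P) (hQ' : Irreducible Q) (h : P ∣ Q) :
    P = Q :=
  eq_of_monic_of_associated hP hQ (hP'.associated_of_dvd hQ' h)

lemma prod_sq_dvd_iff {n : ℕ} {U : Finset F[X]} (hU : U ⊆ monicIrreducibles F n) (D : F[X]) :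
    (∏ P ∈ U, P) ^ 2 ∣ D ↔ ∀ P ∈ U, P ^ 2 ∣ D := by
  constructor
  · exact fun h P hP => (pow_dvd_pow_of_dvd (Finset.dvd_prod_of_mem (fun P => P) hP) 2).trans h
  · intro h
    rw [← Finset.prod_pow]
    refine Finset.prod_dvd_of_coprime (fun P hP Q hQ hPQ => IsCoprime.pow ?_) h
    obtain ⟨-, hPm, hPi⟩ := mem_monicIrreducibles.1 (hU hP)
    obtain ⟨-, hQm, hQi⟩ := mem_monicIrreducibles.1 (hU hQ)
    exact hPi.coprime_iff_not_dvd.2 fun hd => hPQ (hPm.eq_of_irreducible_of_dvd hQm hPi hQi hd)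

lemma prod_injOn_powerset_monicIrreducibles (n : ℕ) :
    Set.InjOn (fun U : Finset F[X] => ∏ P ∈ U, P) (monicIrreducibles F n).powerset := by
  have hsub : ∀ U ∈ (monicIrreducibles F n).powerset, ∀ V ∈ (monicIrreducibles F n).powerset,
      ∏ P ∈ U, P = ∏ P ∈ V, P → U ⊆ V := by
    intro U hU V hV h P hP
    obtain ⟨-, hPm, hPi⟩ := mem_monicIrreducibles.1 (Finset.mem_powerset.1 hU hP)
    have hdvd : P ∣ ∏ Q ∈ V, Q := h ▸ Finset.dvd_prod_of_mem (fun P => P) hP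
    obtain ⟨Q, hQ, hPQ⟩ := (hPi.prime.dvd_finsetProd_iff _).1 hdvd
    obtain ⟨-, hQm, hQi⟩ := mem_monicIrreducibles.1 (Finset.mem_powerset.1 hV hQ)
    exact hPm.eq_of_irreducible_of_dvd hQm hPi hQi hPQ ▸ hQ
  exact fun U hU V hV h => (hsub U hU V hV h).antisymm (hsub V hV U hU h.symm)

open Classical in
lemma squarefree_iff_filter_monicIrreducibles_eq_empty {n : ℕ} {D : F[X]} (hD : D ≠ 0)
    (hn : D.natDegree ≤ n) :
    Squarefree D ↔ (monicIrreducibles F n).filter (· ^ 2 ∣ D) = ∅ := by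
  rw [squarefree_iff_irreducible_sq_not_dvd_of_ne_zero hD, Finset.filter_eq_empty_iff]
  constructor
  · intro h P hP hd
    exact h P (mem_monicIrreducibles.1 hP).2.2 (sq P ▸ hd)
  · intro h P hP hd
    have hassoc : Associated P (normalize P) := (normalize_associated P).symm
    have hd' : normalize P ^ 2 ∣ D := (hassoc.pow_pow.dvd_iff_dvd_left).1 ((sq P).symm ▸ hd)
    refine h (mem_monicIrreducibles.2 ⟨?_, monic_normalize hP.ne_zero, hassoc.irreducible hP⟩) hd'
    rw [degree_normalize, degree_eq_natDegree hP.ne_zero]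
    have := natDegree_le_of_dvd ((dvd_mul_right P P).trans hd) hD
    exact_mod_cast Nat.lt_succ_of_le (this.trans hn)

open Classical in
lemma abs_sum_squarefree_le (hΔ : Δ ≠ 0) (hper : ∀ A B, Δ ∣ A - B → χ A = χ B)
    (hunit : ∀ D, IsCoprime D Δ → χ D = 1 ∨ χ D = -1)
    {G : F[X]} (hG : IsCoprime G Δ) (hχG : χ G = -1) (n : ℕ) :
    |∑ D ∈ monicCoprime Δ n with Squarefree D, χ D| ≤
      (Fintype.card F : ℤ) ^ Δ.natDegree * (Fintype.card F : ℤ) ^ (n / 2 + 1) := by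
  have hsieve : ∑ D ∈ monicCoprime Δ n with Squarefree D, χ D =
      ∑ U ∈ (monicIrreducibles F n).powerset,
        (-1) ^ U.card * ∑ D ∈ monicCoprime Δ n with (∏ P ∈ U, P) ^ 2 ∣ D, χ D := by
    simp_rw [Finset.sum_filter, Finset.mul_sum]
    rw [Finset.sum_comm]
    refine Finset.sum_congr rfl fun D hD => ?_
    obtain ⟨hmon, hdeg, -⟩ := mem_monicCoprime.1 hD
    have hpow : ((monicIrreducibles F n).filter (· ^ 2 ∣ D)).powerset =
        (monicIrreducibles F n).powerset.filter (fun U => (∏ P ∈ U, P) ^ 2 ∣ D) := by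
      ext U
      rw [Finset.mem_powerset, Finset.mem_filter, Finset.mem_powerset]
      constructor
      · intro hU
        have hU' := hU.trans (Finset.filter_subset _ _)
        exact ⟨hU', (prod_sq_dvd_iff hU' D).2 fun P hP => (Finset.mem_filter.1 (hU hP)).2⟩
      · rintro ⟨hU, hd⟩ P hP
        exact Finset.mem_filter.2 ⟨hU hP, (prod_sq_dvd_iff hU D).1 hd P hP⟩
    have hmob := Finset.sum_powerset_neg_one_pow_card
      (x := (monicIrreducibles F n).filter (· ^ 2 ∣ D))
    simp only [← squarefree_iff_filter_monicIrreducibles_eq_empty hmon.ne_zero hdeg.le] at hmob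
    rw [hpow, Finset.sum_filter] at hmob
    calc (if Squarefree D then χ D else 0) = (if Squarefree D then 1 else 0) * χ D := by simp
      _ = _ := by
        rw [← hmob, Finset.sum_mul]
        exact Finset.sum_congr rfl fun U _ => by split_ifs <;> simp
  rw [hsieve]
  have hmonic : ∀ U ∈ (monicIrreducibles F n).powerset, (∏ P ∈ U, P).Monic := fun U hU =>
    monic_prod_of_monic _ _ fun P hP =>
      (mem_monicIrreducibles.1 (Finset.mem_powerset.1 hU hP)).2.1
  have hcard : ((monicIrreducibles F n).powerset.filter
      (fun U => (∏ P ∈ U, P).natDegree ≤ n / 2)).card ≤ Fintype.card F ^ (n / 2 + 1) := by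
    rw [← card_degreeLTFinset]
    refine Finset.card_le_card_of_injOn (fun U => ∏ P ∈ U, P) ?_
      ((prod_injOn_powerset_monicIrreducibles n).mono (Finset.coe_subset.2
        (Finset.filter_subset _ _)))
    intro U hU
    obtain ⟨hU, hdeg⟩ := Finset.mem_filter.1 hU
    refine mem_degreeLTFinset.2 ?_
    rw [degree_eq_natDegree (hmonic U hU).ne_zero]
    exact_mod_cast Nat.lt_succ_of_le hdeg
  calc _ ≤ ∑ U ∈ (monicIrreducibles F n).powerset, if (∏ P ∈ U, P).natDegree ≤ n / 2 then
        (Fintype.card F : ℤ) ^ Δ.natDegree else 0 := by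
        refine (Finset.abs_sum_le_sum_abs _ _).trans (Finset.sum_le_sum fun U hU => ?_)
        rw [abs_mul, abs_pow, abs_neg, abs_one, one_pow, one_mul]
        exact abs_sum_sq_dvd_le hΔ hper hunit hG hχG (hmonic U hU) n
    _ = (Fintype.card F : ℤ) ^ Δ.natDegree * (((monicIrreducibles F n).powerset.filter
          (fun U => (∏ P ∈ U, P).natDegree ≤ n / 2)).card : ℤ) := by
        rw [← Finset.sum_filter, Finset.sum_const, nsmul_eq_mul, mul_comm]
    _ ≤ _ := by
        refine mul_le_mul_of_nonneg_left ?_ (by positivity)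
        exact_mod_cast hcard

end

open Classical in
lemma quadratic_residue_symbol_eq_quadraticChar {F : Type*} [Field F] {P : F[X]}
    [Fact (Irreducible P)] [Fintype (AdjoinRoot P)] {e : F[X] → ℤ}
    (he0 : ∀ D, e D = 0 ↔ P ∣ D)
    (he1 : ∀ D, e D = 1 ↔ ¬P ∣ D ∧ ∃ E : F[X], P ∣ E ^ 2 - D)
    (he2 : ∀ D, e D = -1 ↔ ¬P ∣ D ∧ ¬∃ E : F[X], P ∣ E ^ 2 - D) (D : F[X]) :
    e D = quadraticChar (AdjoinRoot P) (AdjoinRoot.mk P D) := by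
  have hsq : IsSquare (AdjoinRoot.mk P D) ↔ ∃ E : F[X], P ∣ E ^ 2 - D := by
    constructor
    · rintro ⟨r, hr⟩
      obtain ⟨E, rfl⟩ := AdjoinRoot.mk_surjective r
      exact ⟨E, AdjoinRoot.mk_eq_mk.1 (by rw [map_pow, hr, sq])⟩
    · rintro ⟨E, hE⟩
      exact ⟨AdjoinRoot.mk P E, by rw [← AdjoinRoot.mk_eq_mk.2 hE, map_pow, sq]⟩
  by_cases hD : P ∣ D
  · rw [(he0 D).2 hD, AdjoinRoot.mk_eq_zero.2 hD, quadraticChar_zero]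
  · have hne : AdjoinRoot.mk P D ≠ 0 := fun h => hD (AdjoinRoot.mk_eq_zero.1 h)
    by_cases hE : ∃ E : F[X], P ∣ E ^ 2 - D
    · rw [(he1 D).2 ⟨hD, hE⟩, (quadraticChar_one_iff_isSquare hne).2 (hsq.2 hE)]
    · rw [(he2 D).2 ⟨hD, hE⟩, quadraticChar_neg_one_iff_not_isSquare.2 (mt hsq.1 hE)]

lemma exists_monoidHom_of_quadratic_residue_symbol {F : Type*} [Field F] [Fintype F]
    (hF : Odd (Fintype.card F)) {P : F[X]} (hP : Irreducible P) {e : F[X] → ℤ}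
    (he0 : ∀ D, e D = 0 ↔ P ∣ D)
    (he1 : ∀ D, e D = 1 ↔ ¬P ∣ D ∧ ∃ E : F[X], P ∣ E ^ 2 - D)
    (he2 : ∀ D, e D = -1 ↔ ¬P ∣ D ∧ ¬∃ E : F[X], P ∣ E ^ 2 - D) :
    ∃ f : F[X] →* ℤ, (∀ D, e D = f D) ∧ (∀ A B, P ∣ A - B → f A = f B) ∧ ∃ g, f g = -1 := by
  classical
  have : Fact (Irreducible P) := ⟨hP⟩
  have : Module.Finite F (AdjoinRoot P) := (AdjoinRoot.powerBasis hP.ne_zero).finite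
  have : Finite (AdjoinRoot P) := Module.finite_of_finite F
  have := Fintype.ofFinite (AdjoinRoot P)
  have hchar : ringChar (AdjoinRoot P) ≠ 2 := by
    rw [← Algebra.ringChar_eq F (AdjoinRoot P), Ne, FiniteField.even_card_iff_char_two]
    rw [Nat.odd_iff] at hF
    lia
  refine ⟨(quadraticChar (AdjoinRoot P)).toMonoidHom.comp (AdjoinRoot.mk P : F[X] →* AdjoinRoot P),
    quadratic_residue_symbol_eq_quadraticChar he0 he1 he2, fun A B h => ?_, ?_⟩
  · exact congrArg (quadraticChar (AdjoinRoot P)) (AdjoinRoot.mk_eq_mk.2 h)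
  · obtain ⟨a, ha⟩ := quadraticChar_exists_neg_one hchar
    obtain ⟨g, rfl⟩ := AdjoinRoot.mk_surjective a
    exact ⟨g, ha⟩

/-- Prescribe a residue modulo the prime `P` and the residue `1` modulo the part of `Δ` prime
to `P`. -/
lemma exists_isCoprime_dvd_sub {F : Type*} [Field F] {P Δ g : F[X]} (hP : Irreducible P)
    (hΔ : Δ ≠ 0) (hg : ¬P ∣ g) :
    ∃ G, IsCoprime G Δ ∧ P ∣ G - g ∧
      ∀ Q, Irreducible Q → Q ∣ Δ → ¬Associated Q P → Q ∣ G - 1 := by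
  obtain ⟨a, Δ', hndvd, rfl⟩ := WfDvdMonoid.max_power_factor hΔ hP
  obtain ⟨u, v, huv⟩ := hP.coprime_iff_not_dvd.2 hndvd
  set G := u * P + v * Δ' * g with hG
  have hGP : P ∣ G - g := ⟨u - u * g, by linear_combination hG + g * huv⟩
  have hGΔ' : Δ' ∣ G - 1 := ⟨v * (g - 1), by linear_combination hG + huv⟩
  refine ⟨G, IsCoprime.mul_right (IsCoprime.pow_right ?_)
    (isCoprime_of_dvd_sub isCoprime_one_left hGΔ'), hGP, fun Q hQ hQΔ hQP => ?_⟩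
  · exact isCoprime_of_dvd_sub (hP.coprime_iff_not_dvd.2 hg).symm hGP
  · rcases hQ.prime.dvd_or_dvd hQΔ with h | h
    · exact absurd (hQ.associated_of_dvd hP (hQ.prime.dvd_of_dvd_pow h)) hQP
    · exact h.trans hGΔ'

lemma two_mul_card_filter_eq {α : Type*} (X : Finset α) {f : α → ℤ}
    (hf : ∀ x ∈ X, f x = 1 ∨ f x = -1) {s : ℤ} (hs : s = 1 ∨ s = -1) :
    2 * ((X.filter (f · = s)).card : ℤ) = X.card + s * ∑ x ∈ X, f x := by
  rw [Finset.card_filter, Finset.card_eq_sum_ones]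
  push_cast
  rw [Finset.mul_sum, Finset.mul_sum, ← Finset.sum_add_distrib]
  refine Finset.sum_congr rfl fun x hx => ?_
  rcases hf x hx with h | h <;> rcases hs with rfl | rfl <;> simp [h]

lemma pow_div_two_le_sqrt_pow {q : ℝ} (hq : 1 ≤ q) (n : ℕ) : q ^ (n / 2) ≤ √q ^ n := by
  calc q ^ (n / 2) = √q ^ (2 * (n / 2)) := by rw [pow_mul, Real.sq_sqrt (by linarith)]
    _ ≤ √q ^ n := pow_le_pow_right₀ (Real.one_le_sqrt.2 hq) (Nat.mul_div_le n 2)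

/-- Lemma 3.4 of the paper: the two subfamilies of `H_N(Δ)` (monic squarefree polynomials of
degree `N` coprime to `Δ`) cut out by a prescribed value `s = ±1` of the quadratic character
`χ(D) = ∏_{P ∣ M} η_P(D mod P)` each have cardinality `(1/2)|H_N(Δ)| + O_Δ(q^{N/2})`.
Here `η P D` is the quadratic character of the residue field `𝔽_q[T]/(P)` evaluated at
`D mod P`, characterized by: `η P D = 0` iff `P ∣ D`; `η P D = 1` iff `D mod P` is a nonzero
square; `η P D = -1` iff `D mod P` is a nonzero nonsquare. -/
theorem quadratic_twist_sign_subfamilies_half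
    (Fq : Type*) [Field Fq] [Fintype Fq] [DecidableEq Fq]
    (hq : Odd (Fintype.card Fq))
    (Δ M : Fq[X]) (hΔ : Δ ≠ 0) (hMmonic : M.Monic) (hMsf : Squarefree M)
    (hMnc : 0 < M.natDegree) (hMΔ : M ∣ Δ)
    (η : Fq[X] → Fq[X] → ℤ)
    (hη0 : ∀ P D : Fq[X], Irreducible P → P ∣ M → (η P D = 0 ↔ P ∣ D))
    (hη1 : ∀ P D : Fq[X], Irreducible P → P ∣ M →
      (η P D = 1 ↔ ¬P ∣ D ∧ ∃ E : Fq[X], P ∣ E ^ 2 - D))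
    (hη2 : ∀ P D : Fq[X], Irreducible P → P ∣ M →
      (η P D = -1 ↔ ¬P ∣ D ∧ ¬∃ E : Fq[X], P ∣ E ^ 2 - D)) :
    ∃ C : ℝ, ∀ N : ℕ, 1 ≤ N → ∀ s : ℤ, s = 1 ∨ s = -1 →
      |({D : Fq[X] | D.Monic ∧ Squarefree D ∧ D.natDegree = N ∧ IsCoprime D Δ ∧
            (∏ P ∈ (normalizedFactors M).toFinset, η P D) = s}.ncard : ℝ) -
          ({D : Fq[X] | D.Monic ∧ Squarefree D ∧ D.natDegree = N ∧
            IsCoprime D Δ}.ncard : ℝ) / 2| ≤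
        C * Real.sqrt (Fintype.card Fq) ^ N := by
  classical
  have hnf : ∀ P ∈ (normalizedFactors M).toFinset, Irreducible P ∧ P ∣ M := fun P hP =>
    have hP' := Multiset.mem_toFinset.1 hP
    ⟨irreducible_of_normalized_factor P hP', dvd_of_mem_normalizedFactors hP'⟩
  have hη : ∀ P, Irreducible P → P ∣ M →
      ∃ f : Fq[X] →* ℤ, (∀ D, η P D = f D) ∧ (∀ A B, P ∣ A - B → f A = f B) ∧ ∃ g, f g = -1 :=
    fun P hP hPM => exists_monoidHom_of_quadratic_residue_symbol hq hP (fun D => hη0 P D hP hPM)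
      (fun D => hη1 P D hP hPM) fun D => hη2 P D hP hPM
  let χ : Fq[X] →* ℤ :=
    { toFun := fun D => ∏ P ∈ (normalizedFactors M).toFinset, η P D
      map_one' := Finset.prod_eq_one fun P hP => by
        obtain ⟨f, hf, -⟩ := hη P (hnf P hP).1 (hnf P hP).2
        rw [hf, map_one]
      map_mul' := fun A B => by
        rw [← Finset.prod_mul_distrib]
        refine Finset.prod_congr rfl fun P hP => ?_
        obtain ⟨f, hf, -⟩ := hη P (hnf P hP).1 (hnf P hP).2
        simp only [hf, map_mul] }
  have hχ : ∀ D, χ D = ∏ P ∈ (normalizedFactors M).toFinset, η P D := fun _ => rfl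
  have hper : ∀ A B, Δ ∣ A - B → χ A = χ B := fun A B h =>
    Finset.prod_congr rfl fun P hP => by
      obtain ⟨f, hf, hfper, -⟩ := hη P (hnf P hP).1 (hnf P hP).2
      rw [hf, hf, hfper A B (((hnf P hP).2.trans hMΔ).trans h)]
  have hunit : ∀ D, IsCoprime D Δ → χ D = 1 ∨ χ D = -1 := fun D hD => by
    refine Int.isUnit_iff.1 ((hχ D).symm ▸ IsUnit.prod_iff.2 fun P hP => ?_)
    obtain ⟨hPi, hPM⟩ := hnf P hP
    have hPD : ¬P ∣ D := fun h => hPi.not_isUnit (hD.isUnit_of_dvd' h (hPM.trans hMΔ))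
    refine Int.isUnit_iff.2 ?_
    by_cases hE : ∃ E : Fq[X], P ∣ E ^ 2 - D
    · exact Or.inl ((hη1 P D hPi hPM).2 ⟨hPD, hE⟩)
    · exact Or.inr ((hη2 P D hPi hPM).2 ⟨hPD, hE⟩)
  obtain ⟨G, hG, hχG⟩ : ∃ G, IsCoprime G Δ ∧ χ G = -1 := by
    obtain ⟨P, hP⟩ := exists_mem_normalizedFactors hMmonic.ne_zero
      fun h => hMnc.ne' (natDegree_eq_zero_of_isUnit h)
    have hPmem : P ∈ (normalizedFactors M).toFinset := Multiset.mem_toFinset.2 hP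
    obtain ⟨hPi, hPM⟩ := hnf P hPmem
    obtain ⟨f, hf, hfper, g, hg⟩ := hη P hPi hPM
    have hPg : ¬P ∣ g := ((hη2 P g hPi hPM).1 ((hf g).trans hg)).1
    obtain ⟨G, hG, hGg, hG1⟩ := exists_isCoprime_dvd_sub hPi hΔ hPg
    refine ⟨G, hG, ?_⟩
    rw [hχ, Finset.prod_eq_single_of_mem P hPmem, hf, hfper G g hGg, hg]
    intro Q hQ hQP
    obtain ⟨hQi, hQM⟩ := hnf Q hQ
    obtain ⟨k, hk, hkper, -⟩ := hη Q hQi hQM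
    have hassoc : ¬Associated Q P := fun h => hQP <|
      eq_of_monic_of_associated
        (normalize_normalized_factor Q (Multiset.mem_toFinset.1 hQ) ▸ monic_normalize hQi.ne_zero)
        (normalize_normalized_factor P hP ▸ monic_normalize hPi.ne_zero) h
    rw [hk, hkper G 1 (hG1 Q hQi (hQM.trans hMΔ) hassoc), map_one]
  refine ⟨(Fintype.card Fq : ℝ) ^ (Δ.natDegree + 1), fun N _ s hs => ?_⟩
  set q : ℝ := (Fintype.card Fq : ℝ) with hqdef
  have hq1 : 1 ≤ q := by
    rw [hqdef]
    exact_mod_cast Fintype.card_pos (α := Fq)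
  set X := (monicCoprime Δ N).filter Squarefree with hX
  have hmem : ∀ D, D ∈ X ↔ D.Monic ∧ Squarefree D ∧ D.natDegree = N ∧ IsCoprime D Δ := fun D => by
    rw [hX, Finset.mem_filter, mem_monicCoprime]
    tauto
  have hcard : {D : Fq[X] | D.Monic ∧ Squarefree D ∧ D.natDegree = N ∧ IsCoprime D Δ}.ncard =
      X.card := by
    rw [← Set.ncard_coe_finset]
    congr 1
    ext D
    exact (hmem D).symm
  have hcard_sign : {D : Fq[X] | D.Monic ∧ Squarefree D ∧ D.natDegree = N ∧ IsCoprime D Δ ∧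
      (∏ P ∈ (normalizedFactors M).toFinset, η P D) = s}.ncard = (X.filter (χ · = s)).card := by
    rw [← Set.ncard_coe_finset]
    congr 1
    ext D
    rw [Set.mem_ofPred_eq, Finset.mem_coe, Finset.mem_filter, hmem, hχ]
    tauto
  rw [hcard, hcard_sign]
  have htwo : 2 * ((X.filter (χ · = s)).card : ℝ) = X.card + s * ((∑ D ∈ X, χ D : ℤ) : ℝ) := by
    exact_mod_cast two_mul_card_filter_eq X (fun D hD => hunit D ((hmem D).1 hD).2.2.2) hs
  have hsum : |((∑ D ∈ X, χ D : ℤ) : ℝ)| ≤ q ^ Δ.natDegree * q ^ (N / 2 + 1) := by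
    have h := abs_sum_squarefree_le hΔ hper hunit hG hχG N
    rw [← hX] at h
    rw [hqdef]
    exact_mod_cast h
  have hs_abs : |(s : ℝ)| = 1 := by rcases hs with rfl | rfl <;> simp
  calc |((X.filter (χ · = s)).card : ℝ) - (X.card : ℝ) / 2|
      = |s * ((∑ D ∈ X, χ D : ℤ) : ℝ)| / 2 := by
        rw [← abs_of_pos (two_pos (α := ℝ)), ← abs_div, abs_of_pos (two_pos (α := ℝ))]
        congr 1
        linarith
    _ = |((∑ D ∈ X, χ D : ℤ) : ℝ)| / 2 := by rw [abs_mul, hs_abs, one_mul]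
    _ ≤ |((∑ D ∈ X, χ D : ℤ) : ℝ)| := half_le_self (abs_nonneg _)
    _ ≤ q ^ Δ.natDegree * q ^ (N / 2 + 1) := hsum
    _ = q ^ (Δ.natDegree + 1) * q ^ (N / 2) := by ring
    _ ≤ q ^ (Δ.natDegree + 1) * √q ^ N := by
        gcongr
        exact pow_div_two_le_sqrt_pow hq1 N
end

section
/- Let 𝔽_q be a finite field and let Δ ∈ 𝔽_q[T] be nonzero, with ω(Δ) distinct monic irreducible divisors. Then there exists a constant C (depending on q and Δ) such that for all N ≥ 1: | #H_N(Δ) − q^{N−1}(q−1) · ∏_{Q ∣ Δ} q^{deg Q}/(q^{deg Q} + 1) | ≤ C·(N+1)^{ω(Δ)}, where the product runs over the distinct monic irreducible divisors Q of Δ. -/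
open Polynomial UniqueFactorizationMonoid

section SquareDecomposition

/-- If `a ^ 2` divides `b ^ 2 * c` with `c` squarefree, then `a` divides `b`. -/
theorem dvd_of_sq_dvd_sq_mul_squarefree {R : Type*} [CommMonoidWithZero R]
    [GCDMonoid R] {a b c : R} (ha : a ≠ 0) (hc : Squarefree c) (h : a ^ 2 ∣ b ^ 2 * c) :
    a ∣ b := by
  obtain ⟨x, y, hx, hy, hxy⟩ := extract_gcd a b
  have hg : gcd a b ≠ 0 := fun h0 => ha (by rw [hx, h0, zero_mul])
  have h1 : x ^ 2 ∣ y ^ 2 * c := by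
    refine (mul_dvd_mul_iff_left (pow_ne_zero 2 hg)).1 ?_
    rwa [← mul_assoc, ← mul_pow, ← mul_pow, ← hx, ← hy]
  have hrel : IsRelPrime (x ^ 2) (y ^ 2) := (gcd_isUnit_iff_isRelPrime.1 hxy).pow
  have hxu : IsUnit x := hc x (by simpa [sq] using hrel.dvd_of_dvd_mul_left h1)
  rw [hx]
  exact (hxu.mul_right_dvd).2 (gcd_dvd_right a b)

variable {F : Type*} [Field F]

/-- A monic polynomial is the product of the square of a monic polynomial and a monic
squarefree polynomial. -/
theorem Polynomial.Monic.exists_sq_mul_squarefree {D : F[X]} (hD : D.Monic) :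
    ∃ A B : F[X], A.Monic ∧ B.Monic ∧ Squarefree B ∧ D = A ^ 2 * B := by
  classical
  induction hn : D.natDegree using Nat.strong_induction_on generalizing D with
  | _ n ih =>
    by_cases hs : Squarefree D
    · exact ⟨1, D, monic_one, hD, hs, by simp⟩
    · simp only [Squarefree, not_forall] at hs
      obtain ⟨x, hx, hxu⟩ := hs
      have hx0 : x ≠ 0 := by
        rintro rfl
        exact hD.ne_zero (by simpa using hx)
      have hm : (normalize x).Monic := monic_normalize hx0
      have hxn : Associated (normalize x) x := normalize_associated x
      obtain ⟨c, hc⟩ := (hxn.mul_mul hxn).dvd.trans hx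
      have hcm : c.Monic := Monic.of_mul_monic_left (hm.mul hm) (hc ▸ hD)
      have hdeg : 0 < (normalize x).natDegree := Nat.pos_of_ne_zero fun h =>
        hxu (normalize_eq_one.1 (hm.natDegree_eq_zero.1 h))
      have hlt : c.natDegree < n := by
        rw [← hn, hc, (hm.mul hm).natDegree_mul hcm, hm.natDegree_mul hm]
        omega
      obtain ⟨A, B, hA, hB, hBs, rfl⟩ := ih _ hlt hcm rfl
      exact ⟨normalize x * A, B, hm.mul hA, hB, hBs, by rw [hc]; ring⟩

theorem Polynomial.Monic.eq_of_sq_mul_squarefree_eq {A A' B B' : F[X]} (hA : A.Monic)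
    (hA' : A'.Monic) (hB : Squarefree B) (hB' : Squarefree B') (h : A ^ 2 * B = A' ^ 2 * B') :
    A = A' ∧ B = B' := by
  let _ : GCDMonoid F[X] := UniqueFactorizationMonoid.toGCDMonoid _
  have hAA : A = A' := eq_of_monic_of_associated hA hA' <| associated_of_dvd_dvd
    (dvd_of_sq_dvd_sq_mul_squarefree hA.ne_zero hB' (Dvd.intro B h))
    (dvd_of_sq_dvd_sq_mul_squarefree hA'.ne_zero hB (Dvd.intro B' h.symm))
  subst hAA
  exact ⟨rfl, mul_left_cancel₀ (pow_ne_zero 2 hA.ne_zero) h⟩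

end SquareDecomposition

section Counting

variable (F : Type*) [Field F] [Fintype F]

theorem finite_monic_natDegree_eq (n : ℕ) : {p : F[X] | p.Monic ∧ p.natDegree = n}.Finite := by
  have : Finite {p : F[X] // p.Monic ∧ p.natDegree = n} :=
    Finite.of_equiv _ ((monicEquivDegreeLT n).trans (degreeLTEquiv F n).toEquiv).symm
  exact Set.finite_coe_iff.1 this

/-- The monic polynomials of degree `n` over a finite field. -/
noncomputable def monicsOfDegree (n : ℕ) : Finset F[X] := (finite_monic_natDegree_eq F n).toFinset

variable {F} in
theorem mem_monicsOfDegree {n : ℕ} {p : F[X]} :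
    p ∈ monicsOfDegree F n ↔ p.Monic ∧ p.natDegree = n := by
  simp [monicsOfDegree]

theorem card_monicsOfDegree (n : ℕ) : (monicsOfDegree F n).card = Fintype.card F ^ n := by
  rw [monicsOfDegree, ← Set.ncard_eq_toFinset_card _ (finite_monic_natDegree_eq F n), ← Nat.card_coe_set_eq]
  refine (Nat.card_congr ((monicEquivDegreeLT n).trans (degreeLTEquiv F n).toEquiv)).trans ?_
  simp

variable {F}

open scoped Classical in
/-- The monic squarefree polynomials of degree `n` not divisible by any element of `S`. -/
noncomputable def squarefreesAvoiding (S : Finset F[X]) (n : ℕ) : Finset F[X] :=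
  {D ∈ monicsOfDegree F n | Squarefree D ∧ ∀ P ∈ S, ¬ P ∣ D}

theorem mem_squarefreesAvoiding {S : Finset F[X]} {n : ℕ} {D : F[X]} :
    D ∈ squarefreesAvoiding S n ↔
      D.Monic ∧ D.natDegree = n ∧ Squarefree D ∧ ∀ P ∈ S, ¬ P ∣ D := by
  simp [squarefreesAvoiding, mem_monicsOfDegree, and_assoc]

theorem sum_card_squarefreesAvoiding_empty (n : ℕ) :
    ∑ k ∈ Finset.range (n / 2 + 1),
      Fintype.card F ^ k * (squarefreesAvoiding (∅ : Finset F[X]) (n - 2 * k)).card =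
        Fintype.card F ^ n := by
  simp_rw [← card_monicsOfDegree, ← Finset.card_product]
  rw [← Finset.card_sigma]
  refine Finset.card_bij (fun x _ => x.2.1 ^ 2 * x.2.2) ?_ ?_ ?_
  · rintro ⟨k, A, B⟩ h
    simp only [Finset.mem_sigma, Finset.mem_range, Finset.mem_product, mem_monicsOfDegree,
      mem_squarefreesAvoiding] at h ⊢
    obtain ⟨hk, ⟨hA, hAk⟩, hB, hBk, -⟩ := h
    refine ⟨(hA.pow 2).mul hB, ?_⟩
    rw [(hA.pow 2).natDegree_mul hB, hA.natDegree_pow]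
    omega
  · rintro ⟨k, A, B⟩ h ⟨k', A', B'⟩ h' heq
    simp only [Finset.mem_sigma, Finset.mem_product, mem_monicsOfDegree,
      mem_squarefreesAvoiding] at h h' heq
    obtain ⟨-, ⟨hA, rfl⟩, -, -, hB, -⟩ := h
    obtain ⟨-, ⟨hA', rfl⟩, -, -, hB', -⟩ := h'
    obtain ⟨rfl, rfl⟩ := hA.eq_of_sq_mul_squarefree_eq hA' hB hB' heq
    rfl
  · intro D h
    obtain ⟨hD, hn⟩ := mem_monicsOfDegree.1 h
    obtain ⟨A, B, hA, hB, hs, rfl⟩ := hD.exists_sq_mul_squarefree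
    rw [(hA.pow 2).natDegree_mul hB, hA.natDegree_pow] at hn
    refine ⟨⟨A.natDegree, A, B⟩, ?_, rfl⟩
    simp only [Finset.mem_sigma, Finset.mem_range, Finset.mem_product, mem_monicsOfDegree,
      mem_squarefreesAvoiding]
    exact ⟨by omega, ⟨hA, trivial⟩, hB, by omega, hs, by simp⟩

theorem card_squarefreesAvoiding_empty_add_two (n : ℕ) :
    (squarefreesAvoiding (∅ : Finset F[X]) (n + 2)).card + Fintype.card F ^ (n + 1) =
      Fintype.card F ^ (n + 2) := by
  rw [← sum_card_squarefreesAvoiding_empty (n + 2), show (n + 2) / 2 + 1 = n / 2 + 1 + 1 by omega,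
    Finset.sum_range_succ', pow_succ' _ n, ← sum_card_squarefreesAvoiding_empty n, Finset.mul_sum,
    add_comm]
  simp only [pow_zero, one_mul, mul_zero, Nat.sub_zero]
  congr 1
  refine Finset.sum_congr rfl fun k _ => ?_
  rw [show n + 2 - 2 * (k + 1) = n - 2 * k by omega, pow_succ', mul_assoc]

theorem card_squarefreesAvoiding_empty_of_lt_two {n : ℕ} (hn : n < 2) :
    (squarefreesAvoiding (∅ : Finset F[X]) n).card = Fintype.card F ^ n := by
  rw [← sum_card_squarefreesAvoiding_empty n, show n / 2 = 0 by omega]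
  simp

theorem card_squarefreesAvoiding_insert [DecidableEq F[X]] {S : Finset F[X]} {Q : F[X]}
    (hS : ∀ P ∈ S, P.Monic ∧ Irreducible P) (hQm : Q.Monic) (hQ : Irreducible Q) (hQS : Q ∉ S)
    {n : ℕ} (hn : Q.natDegree ≤ n) :
    (squarefreesAvoiding S n).card = (squarefreesAvoiding (insert Q S) n).card +
      (squarefreesAvoiding (insert Q S) (n - Q.natDegree)).card := by
  classical
  rw [← Finset.card_filter_add_card_filter_not (fun D => ¬ Q ∣ D)]
  congr 1
  · congr 1
    ext D
    simp only [Finset.mem_filter, mem_squarefreesAvoiding, Finset.forall_mem_insert]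
    tauto
  · symm
    refine Finset.card_bij (fun E _ => Q * E) ?_ ?_ ?_
    · intro E h
      simp only [Finset.mem_filter, mem_squarefreesAvoiding, Finset.forall_mem_insert,
        not_not] at h ⊢
      obtain ⟨hE, hd, hs, hQE, hP⟩ := h
      refine ⟨⟨hQm.mul hE, ?_, ?_, fun P hPS hdvd => ?_⟩, dvd_mul_right _ _⟩
      · rw [hQm.natDegree_mul hE]
        omega
      · exact squarefree_mul_iff.2 ⟨hQ.isRelPrime_iff_not_dvd.2 hQE, hQ.squarefree, hs⟩
      · rcases (hS P hPS).2.prime.dvd_or_dvd hdvd with h | h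
        · refine hQS ?_
          rwa [← eq_of_monic_of_associated (hS P hPS).1 hQm
            ((hS P hPS).2.associated_of_dvd hQ h)]
        · exact hP P hPS h
    · intro E _ E' _ h
      exact mul_left_cancel₀ hQ.ne_zero h
    · intro D h
      simp only [Finset.mem_filter, mem_squarefreesAvoiding, not_not] at h
      obtain ⟨⟨hD, hd, hs, hP⟩, E, rfl⟩ := h
      have hE : E.Monic := Monic.of_mul_monic_left hQm hD
      rw [squarefree_mul_iff, hQ.isRelPrime_iff_not_dvd] at hs
      rw [hQm.natDegree_mul hE] at hd
      refine ⟨E, ?_, rfl⟩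
      simp only [mem_squarefreesAvoiding, Finset.forall_mem_insert]
      exact ⟨hE, by omega, hs.2.2, hs.1, fun P hPS h => hP P hPS (h.mul_left _)⟩

theorem card_squarefreesAvoiding_insert_of_lt [DecidableEq F[X]] {S : Finset F[X]} {Q : F[X]}
    {n : ℕ} (hn : n < Q.natDegree) :
    (squarefreesAvoiding (insert Q S) n).card = (squarefreesAvoiding S n).card := by
  congr 1
  ext D
  simp only [mem_squarefreesAvoiding, Finset.forall_mem_insert]
  refine ⟨fun h => ⟨h.1, h.2.1, h.2.2.1, h.2.2.2.2⟩,
    fun h => ⟨h.1, h.2.1, h.2.2.1, fun hdvd => ?_, h.2.2.2⟩⟩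
  have := natDegree_le_of_dvd hdvd h.1.ne_zero
  omega

/-- If `e' n + e' (n - d) = e n` for `n ≥ d` and `e` has polynomial growth of order `w`, then
`e'` has polynomial growth of order `w + 1`. -/
theorem abs_le_of_add_shift_eq {e e' : ℕ → ℝ} {C K : ℝ} {d w : ℕ} (hd : 0 < d) (hK : 0 ≤ K)
    (he : ∀ n, |e n| ≤ C * ((n : ℝ) + 1) ^ w) (hlt : ∀ n < d, |e' n| ≤ |e n| + K)
    (hge : ∀ n, d ≤ n → e' n + e' (n - d) = e n) (n : ℕ) :
    |e' n| ≤ (C + K) * ((n : ℝ) + 1) ^ (w + 1) := by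
  have hC : 0 ≤ C := by simpa using (abs_nonneg _).trans (he 0)
  induction n using Nat.strong_induction_on with
  | _ n ih =>
    have h1 : (1 : ℝ) ≤ (n : ℝ) + 1 := by simp
    rcases lt_or_ge n d with hn | hn
    · calc |e' n| ≤ C * ((n : ℝ) + 1) ^ w + K * 1 := by linarith [hlt n hn, he n]
        _ ≤ C * ((n : ℝ) + 1) ^ (w + 1) + K * ((n : ℝ) + 1) ^ (w + 1) := by
          gcongr
          · omega
          · exact one_le_pow₀ h1
        _ = _ := by ring
    · have hsub : ((n - d : ℕ) : ℝ) + 1 ≤ n := by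
        have : n - d + 1 ≤ n := by omega
        exact_mod_cast this
      calc |e' n| = |e n - e' (n - d)| := by rw [← hge n hn]; ring_nf
        _ ≤ |e n| + |e' (n - d)| := abs_sub _ _
        _ ≤ C * ((n : ℝ) + 1) ^ w + (C + K) * (((n - d : ℕ) : ℝ) + 1) ^ (w + 1) :=
          add_le_add (he n) (ih _ (by omega))
        _ ≤ (C + K) * ((n : ℝ) + 1) ^ w + (C + K) * (((n : ℝ) + 1) ^ w * n) := by
          rw [pow_succ (((n - d : ℕ) : ℝ) + 1)]
          gcongr
          · linarith
          · omega
        _ = _ := by ring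

theorem exists_card_squarefreesAvoiding_sub_le [DecidableEq F[X]] (S : Finset F[X])
    (hS : ∀ P ∈ S, P.Monic ∧ Irreducible P) :
    ∃ C : ℝ, ∀ n : ℕ, |((squarefreesAvoiding S n).card : ℝ) -
      (Fintype.card F : ℝ) ^ n * (1 - (Fintype.card F : ℝ)⁻¹) *
        ∏ Q ∈ S, (Fintype.card F : ℝ) ^ Q.natDegree / ((Fintype.card F : ℝ) ^ Q.natDegree + 1)| ≤
      C * ((n : ℝ) + 1) ^ S.card := by
  have hq : (1 : ℝ) < Fintype.card F := by exact_mod_cast Fintype.one_lt_card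
  set q : ℝ := (Fintype.card F : ℝ) with hqdef
  have hq0 : 0 < q := by linarith
  have hqi : q⁻¹ ≤ 1 := inv_le_one_of_one_le₀ hq.le
  have hqi0 : 0 < q⁻¹ := inv_pos.2 hq0
  induction S using Finset.induction_on with
  | empty =>
    refine ⟨1, fun n => ?_⟩
    simp only [Finset.prod_empty, mul_one, Finset.card_empty, pow_zero]
    rcases n with _ | _ | n
    · rw [card_squarefreesAvoiding_empty_of_lt_two (by norm_num), abs_le]
      constructor <;> simp <;> linarith
    · rw [card_squarefreesAvoiding_empty_of_lt_two (by norm_num)]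
      push_cast
      rw [← hqdef, mul_sub, pow_one, mul_inv_cancel₀ hq0.ne']
      simp
    · have h : ((squarefreesAvoiding (∅ : Finset F[X]) (n + 2)).card : ℝ) + q ^ (n + 1) =
          q ^ (n + 2) := by
        rw [hqdef]
        exact_mod_cast card_squarefreesAvoiding_empty_add_two (F := F) n
      have h2 : q ^ (n + 2) * (1 - q⁻¹) = q ^ (n + 2) - q ^ (n + 1) := by
        field_simp
        ring
      rw [h2, ← h]
      simp
  | insert Q S hQS ih =>
    rw [Finset.forall_mem_insert] at hS
    obtain ⟨⟨hQm, hQ⟩, hS⟩ := hS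
    obtain ⟨C, hC⟩ := ih hS
    rw [Finset.card_insert_of_notMem hQS, Finset.prod_insert hQS]
    set c : ℝ := ∏ P ∈ S, q ^ P.natDegree / (q ^ P.natDegree + 1)
    set d := Q.natDegree
    have hd : 0 < d := hQ.natDegree_pos
    have hc : 0 ≤ c := Finset.prod_nonneg fun P _ => by positivity
    have hqd : 0 < q ^ d := by positivity
    refine ⟨C + q ^ d * c, abs_le_of_add_shift_eq hd (by positivity) hC ?_ ?_⟩
    · intro n hn
      rw [card_squarefreesAvoiding_insert_of_lt hn]
      have hdiff : 0 ≤ q ^ n * (1 - q⁻¹) * (1 - q ^ d / (q ^ d + 1)) ∧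
          q ^ n * (1 - q⁻¹) * (1 - q ^ d / (q ^ d + 1)) ≤ q ^ d := by
        have h3 : q ^ d / (q ^ d + 1) ≤ 1 := by
          rw [div_le_one (by positivity)]
          linarith
        have h4 : 0 ≤ q ^ d / (q ^ d + 1) := by positivity
        have h5 : 0 ≤ 1 - q⁻¹ := by linarith
        have h6 : 0 ≤ 1 - q ^ d / (q ^ d + 1) := by linarith
        refine ⟨by positivity, ?_⟩
        calc q ^ n * (1 - q⁻¹) * (1 - q ^ d / (q ^ d + 1)) ≤ q ^ d * 1 * 1 := by
              gcongr
              · exact hq.le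
              · linarith
              · linarith
          _ = q ^ d := by ring
      calc _ = |((squarefreesAvoiding S n).card - q ^ n * (1 - q⁻¹) * c) +
            q ^ n * (1 - q⁻¹) * (1 - q ^ d / (q ^ d + 1)) * c| := by ring_nf
        _ ≤ _ := abs_add_le _ _
        _ ≤ _ := by
          rw [abs_of_nonneg (mul_nonneg hdiff.1 hc)]
          gcongr
          exact hdiff.2
    · intro n hn
      rw [card_squarefreesAvoiding_insert hS hQm hQ hQS hn]
      obtain ⟨m, rfl⟩ := Nat.exists_eq_add_of_le hn
      rw [Nat.add_sub_cancel_left]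
      push_cast
      field_simp
      ring

end Counting

theorem isCoprime_iff_forall_normalizedFactors_not_dvd {F : Type*} [Field F] [DecidableEq F]
    {D Δ : F[X]} (hΔ : Δ ≠ 0) :
    IsCoprime D Δ ↔ ∀ P ∈ (normalizedFactors Δ).toFinset, ¬ P ∣ D := by
  simp only [Multiset.mem_toFinset, Polynomial.mem_normalizedFactors_iff hΔ]
  refine ⟨fun h P hP hPD => hP.1.not_isUnit (h.isUnit_of_dvd' hPD hP.2.2), fun h => ?_⟩
  refine isCoprime_of_irreducible_dvd (fun h0 => hΔ h0.2) fun z hz hzD hzΔ => ?_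
  have ha : Associated (normalize z) z := normalize_associated z
  exact h _ ⟨ha.symm.irreducible hz, monic_normalize hz.ne_zero, ha.dvd.trans hzΔ⟩
    (ha.dvd.trans hzD)

/-- Lemma 3.5 of the paper: the count of monic squarefree polynomials of degree `N` coprime
to `Δ` satisfies
`#H_N(Δ) = q^{N-1}(q-1)·∏_{Q ∣ Δ} q^{deg Q}/(q^{deg Q}+1) + O((N+1)^{ω(Δ)})`,
the product running over the distinct monic irreducible divisors of `Δ`. -/
theorem squarefree_coprime_count_asymptotic
    (Fq : Type*) [Field Fq] [Fintype Fq] [DecidableEq Fq]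
    (Δ : Fq[X]) (hΔ : Δ ≠ 0) :
    ∃ C : ℝ, ∀ N : ℕ, 1 ≤ N →
      |({D : Fq[X] | D.Monic ∧ Squarefree D ∧ D.natDegree = N ∧
            IsCoprime D Δ}.ncard : ℝ) -
          (Fintype.card Fq : ℝ) ^ (N - 1) * ((Fintype.card Fq : ℝ) - 1) *
            ∏ Q ∈ (normalizedFactors Δ).toFinset,
              (Fintype.card Fq : ℝ) ^ Q.natDegree /
                ((Fintype.card Fq : ℝ) ^ Q.natDegree + 1)| ≤
        C * ((N : ℝ) + 1) ^ ((normalizedFactors Δ).toFinset.card) := by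
  obtain ⟨C, hC⟩ := exists_card_squarefreesAvoiding_sub_le (normalizedFactors Δ).toFinset
    fun P hP => by
      rw [Multiset.mem_toFinset, Polynomial.mem_normalizedFactors_iff hΔ] at hP
      exact ⟨hP.2.1, hP.1⟩
  refine ⟨C, fun N hN => ?_⟩
  have hset : {D : Fq[X] | D.Monic ∧ Squarefree D ∧ D.natDegree = N ∧ IsCoprime D Δ} =
      squarefreesAvoiding (normalizedFactors Δ).toFinset N := by
    ext D
    rw [Set.mem_ofPred_eq, isCoprime_iff_forall_normalizedFactors_not_dvd hΔ, Finset.mem_coe,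
      mem_squarefreesAvoiding]
    tauto
  have hq : (Fintype.card Fq : ℝ) ≠ 0 := by simp
  have hmain : (Fintype.card Fq : ℝ) ^ (N - 1) * ((Fintype.card Fq : ℝ) - 1) =
      (Fintype.card Fq : ℝ) ^ N * (1 - (Fintype.card Fq : ℝ)⁻¹) := by
    obtain ⟨m, rfl⟩ := Nat.exists_eq_add_of_le' hN
    rw [Nat.add_sub_cancel, pow_succ]
    field_simp
  rw [hset, Set.ncard_coe_finset, hmain]
  exact hC N
end
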